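/- Fix i ∈ {1,…,d} and fix a_j ∈ [r_j, M_j−b_j] for every j ≠ i. Assume the single-site potential q satisfies (H1), is not identically zero, and is sign-definite (either q(n) ≥ 0 for all n or q(n) ≤ 0 for all n). Then the map a_i ↦ E_0(a_1,…,a_d) is strictly decreasing on the integer interval [r_i, M_i − b_i]. -/

import Mathlib

open scoped BigOperators

noncomputable section

/-- Points of the lattice `ℤ^d`. -/
abbrev Zd (d : ℕ) := Fin d → ℤ

/-- 1-norm distance on `ℤ^d`. -/
def dist1 {d : ℕ} (x y : Zd d) : ℤ := ∑ i, |x i - y i|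

/-- The set of nearest neighbors of a point of `ℤ^d`. -/
def nbhd {d : ℕ} (n : Zd d) : Finset (Zd d) :=
  (Fintype.piFinset fun i => Finset.Icc (n i - 1) (n i + 1)).filter fun m => dist1 n m = 1

/-- A discrete box `∏ [lo i, hi i]`. -/
def dbox {d : ℕ} (lo hi : Zd d) : Finset (Zd d) :=
  Fintype.piFinset fun i => Finset.Icc (lo i) (hi i)

/-- `n_S(i)`: the number of nearest neighbors of `i` lying outside `S`. -/
def nOut {d : ℕ} (S : Finset (Zd d)) (i : Zd d) : ℕ :=
  ((nbhd i).filter fun j => j ∉ S).card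

/-- The matrix of the Neumann Laplacian `h^N_{0,S}` plus a potential `V` on the finite
set `S ⊂ ℤ^d`:  off-diagonal entries `-1` at nearest neighbor pairs, diagonal entries
`V i - n_S(i)`. -/
def neumannMat {d : ℕ} (S : Finset (Zd d)) (V : Zd d → ℝ) : Matrix S S ℝ :=
  fun i j => (if dist1 (i : Zd d) (j : Zd d) = 1 then (-1 : ℝ) else 0)
    + (if i = j then (V (i : Zd d) - (nOut S (i : Zd d) : ℝ)) else 0)

/-- `E_0(a) = min σ(h^N_{0,Λ} + q_a)` for `Λ = ∏ [1, M i]` and `q_a = q(· - a)`. -/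
def E0 {d : ℕ} (M : Zd d) (q : Zd d → ℝ) (a : Zd d) : ℝ :=
  sInf (spectrum ℝ (neumannMat (dbox (fun _ => 1) M) (fun n => q (n - a))))

theorem Matrix.IsHermitian.posSemidef_sub_sInf_spectrum {n : Type*} [Fintype n] [DecidableEq n]
    {A : Matrix n n ℝ} (hA : A.IsHermitian) :
    (A - algebraMap ℝ _ (sInf (spectrum ℝ A))).PosSemidef := by
  have hE : (A - algebraMap ℝ _ (sInf (spectrum ℝ A))).IsHermitian := by
    refine hA.sub ?_
    rw [Matrix.algebraMap_eq_diagonal]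
    exact Matrix.isHermitian_diagonal _
  rw [hE.posSemidef_iff_eigenvalues_nonneg]
  intro i
  have h := hE.eigenvalues_mem_spectrum_real i
  rw [← spectrum.sub_singleton_eq] at h
  obtain ⟨x, hx, y, rfl, hxy⟩ := Set.mem_sub.1 h
  rw [← hxy]
  exact sub_nonneg.2 (csInf_le (Matrix.finite_real_spectrum).bddBelow hx)

theorem Matrix.IsHermitian.sInf_spectrum_mul_le {n : Type*} [Fintype n] [DecidableEq n]
    {A : Matrix n n ℝ} (hA : A.IsHermitian) (v : n → ℝ) :
    sInf (spectrum ℝ A) * (v ⬝ᵥ v) ≤ v ⬝ᵥ A.mulVec v := by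
  have h := hA.posSemidef_sub_sInf_spectrum.dotProduct_mulVec_nonneg v
  simp only [Algebra.algebraMap_eq_smul_one, Matrix.sub_mulVec, Matrix.smul_mulVec,
    Matrix.one_mulVec, dotProduct_sub, dotProduct_smul, star_trivial, smul_eq_mul] at h
  linarith

theorem Matrix.IsHermitian.exists_nonneg_ground_state {n : Type*} [Fintype n] [DecidableEq n]
    [Nonempty n] {A : Matrix n n ℝ} (hA : A.IsHermitian) (hoff : ∀ i j, i ≠ j → A i j ≤ 0) :
    ∃ u : n → ℝ, (∀ x, 0 ≤ u x) ∧ u ≠ 0 ∧ A.mulVec u = sInf (spectrum ℝ A) • u := by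
  have hne : (spectrum ℝ A).Nonempty :=
    ⟨_, hA.eigenvalues_mem_spectrum_real (Classical.arbitrary n)⟩
  have hmem := hne.csInf_mem Matrix.finite_real_spectrum
  have hP := hA.posSemidef_sub_sInf_spectrum
  set E := sInf (spectrum ℝ A)
  rw [← Matrix.spectrum_toLin', ← Module.End.hasEigenvalue_iff_mem_spectrum] at hmem
  obtain ⟨v, hv⟩ := hmem.exists_hasEigenvector
  have hv1 : A.mulVec v = E • v := by simpa using hv.apply_eq_smul
  refine ⟨fun x => |v x|, fun x => abs_nonneg _, fun h => hv.2 ?_, ?_⟩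
  · ext x
    simpa using congrFun h x
  have hle : (fun x => |v x|) ⬝ᵥ A.mulVec (fun x => |v x|) ≤ v ⬝ᵥ A.mulVec v := by
    simp only [dotProduct, Matrix.mulVec, Finset.mul_sum]
    refine Finset.sum_le_sum fun i _ => Finset.sum_le_sum fun j _ => ?_
    by_cases hij : i = j
    · subst hij
      rw [mul_left_comm, abs_mul_abs_self, mul_left_comm]
    · have h1 := hoff i j hij
      have h2 : v i * v j ≤ |v i| * |v j| := by
        rw [← abs_mul]; exact le_abs_self _
      nlinarith
  have hsq : (fun x => |v x|) ⬝ᵥ (fun x => |v x|) = v ⬝ᵥ v := by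
    simp [dotProduct]
  have h0 : star (fun x => |v x|) ⬝ᵥ
      (A - algebraMap ℝ _ E).mulVec (fun x => |v x|) = 0 := by
    refine le_antisymm ?_ (hP.dotProduct_mulVec_nonneg _)
    simp only [Algebra.algebraMap_eq_smul_one, Matrix.sub_mulVec, Matrix.smul_mulVec,
      Matrix.one_mulVec, dotProduct_sub, dotProduct_smul, star_trivial, smul_eq_mul, hsq]
    rw [hv1, dotProduct_smul, smul_eq_mul] at hle
    linarith
  have h1 := (hP.dotProduct_mulVec_zero_iff _).1 h0
  simpa [Algebra.algebraMap_eq_smul_one, Matrix.sub_mulVec, Matrix.smul_mulVec, sub_eq_zero] using h1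

/-- The unit vector of `ℤ^d` in direction `j`. -/
def latticeUnit {d : ℕ} (j : Fin d) : Zd d := Pi.single j 1

theorem latticeUnit_same {d : ℕ} (j : Fin d) : latticeUnit j j = 1 := by simp [latticeUnit]

theorem latticeUnit_ne {d : ℕ} {j k : Fin d} (h : k ≠ j) : latticeUnit j k = 0 := by
  simp [latticeUnit, h]

theorem mem_dbox {d : ℕ} {lo hi x : Zd d} : x ∈ dbox lo hi ↔ ∀ j, lo j ≤ x j ∧ x j ≤ hi j := by
  simp [dbox, Fintype.mem_piFinset]

theorem dist1_eq_one_iff {d : ℕ} {x y : Zd d} :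
    dist1 x y = 1 ↔ ∃ j, y = x + latticeUnit j ∨ y = x - latticeUnit j := by
  constructor
  · intro h
    have hex : ∃ j, x j ≠ y j := by
      by_contra! hcon
      simp [dist1, hcon] at h
    obtain ⟨j, hj⟩ := hex
    have hsum := Finset.add_sum_erase Finset.univ (fun i => |x i - y i|) (Finset.mem_univ j)
    have hdist : ∑ i, |x i - y i| = 1 := h
    have hpos : 0 < |x j - y j| := abs_pos.2 (sub_ne_zero.2 hj)
    have hnn : 0 ≤ ∑ i ∈ Finset.univ.erase j, |x i - y i| :=
      Finset.sum_nonneg fun i _ => abs_nonneg _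
    simp only [hdist] at hsum
    have hrest : ∑ i ∈ Finset.univ.erase j, |x i - y i| = 0 := by omega
    have hj1 : |x j - y j| = 1 := by omega
    rw [Finset.sum_eq_zero_iff_of_nonneg fun i _ => abs_nonneg _] at hrest
    have hother : ∀ k, k ≠ j → x k = y k := fun k hk =>
      sub_eq_zero.1 (abs_eq_zero.1 (hrest k (by simp [hk])))
    refine ⟨j, ?_⟩
    rcases (abs_eq (by norm_num)).1 hj1 with h1 | h1
    · right
      ext k
      by_cases hk : k = j
      · subst hk
        simp only [Pi.sub_apply, latticeUnit_same]; omega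
      · simp [latticeUnit_ne hk, hother k hk]
    · left
      ext k
      by_cases hk : k = j
      · subst hk
        simp only [Pi.add_apply, latticeUnit_same]; omega
      · simp [latticeUnit_ne hk, hother k hk]
  · rintro ⟨j, rfl | rfl⟩ <;>
    simp [dist1, latticeUnit, Pi.single_apply, apply_ite abs]

theorem mem_nbhd {d : ℕ} {x y : Zd d} : y ∈ nbhd x ↔ dist1 x y = 1 := by
  refine ⟨fun h => (Finset.mem_filter.1 h).2, fun h => Finset.mem_filter.2 ⟨?_, h⟩⟩
  rw [Fintype.mem_piFinset]
  intro k
  have hk : |x k - y k| ≤ 1 :=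
    h ▸ Finset.single_le_sum (f := fun i => |x i - y i|) (fun i _ => abs_nonneg _)
      (Finset.mem_univ k)
  rw [abs_le] at hk
  rw [Finset.mem_Icc]
  omega

theorem sum_nbhd {d : ℕ} (x : Zd d) (f : Zd d → ℝ) :
    ∑ y ∈ nbhd x, f y = ∑ j, (f (x + latticeUnit j) + f (x - latticeUnit j)) := by
  have himage : nbhd x = (Finset.univ : Finset (Fin d × Bool)).image
      (fun p => if p.2 then x + latticeUnit p.1 else x - latticeUnit p.1) := by
    ext y
    simp only [mem_nbhd, dist1_eq_one_iff, Finset.mem_image, Finset.mem_univ, true_and,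
      Prod.exists, Bool.exists_bool]
    simp only [if_true, Bool.false_eq_true, if_false]
    exact exists_congr fun j => by rw [or_comm, eq_comm, @eq_comm _ y]
  rw [himage, Finset.sum_image, Fintype.sum_prod_type]
  · simp
  · rintro ⟨j, s⟩ - ⟨k, t⟩ - h
    have hj := congrFun h j
    have hk := congrFun h k
    by_cases hjk : j = k
    · subst hjk
      cases s <;> cases t <;> simp_all [latticeUnit_same] <;> omega
    · have hne : (latticeUnit j : Zd d) ≠ latticeUnit k := fun h' => by
        simpa [latticeUnit_same, latticeUnit_ne hjk] using congrFun h' j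
      cases s <;> cases t <;> simp_all [latticeUnit_same, latticeUnit_ne hjk]

/-- The coordinatewise projection of `ℤ^d` onto the box `∏ [1, M j]`. -/
def clampBox {d : ℕ} (M x : Zd d) : Zd d := fun j => max 1 (min (M j) (x j))

/-- The Neumann boundary condition on `∏ [1, M j]`: `w` is constant along the fibres of the
projection onto the box. -/
def IsReflecting {d : ℕ} (M : Zd d) (w : Zd d → ℝ) : Prop := ∀ x, w (clampBox M x) = w x

/-- The lattice Schrödinger operator `-∑_{|y-x|=1} w(y) + V(x) w(x)`. -/
def latticeOp {d : ℕ} (V w : Zd d → ℝ) (x : Zd d) : ℝ :=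
  V x * w x - ∑ j, (w (x + latticeUnit j) + w (x - latticeUnit j))

theorem clampBox_mem {d : ℕ} {M : Zd d} (hM : ∀ j, 1 ≤ M j) (x : Zd d) :
    clampBox M x ∈ dbox (fun _ => 1) M := by
  rw [mem_dbox]
  intro j
  have := hM j
  simp only [clampBox]
  omega

theorem clampBox_of_mem {d : ℕ} {M x : Zd d} (hx : x ∈ dbox (fun _ => 1) M) :
    clampBox M x = x := by
  ext j
  have := mem_dbox.1 hx j
  simp only [clampBox]
  omega

theorem clampBox_add_unit {d : ℕ} {M x : Zd d} {j : Fin d} (hx : x ∈ dbox (fun _ => 1) M)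
    (h : x + latticeUnit j ∉ dbox (fun _ => 1) M) : clampBox M (x + latticeUnit j) = x := by
  rw [mem_dbox] at hx
  have hj : M j < x j + 1 := by
    by_contra! hcon
    refine h (mem_dbox.2 fun k => ?_)
    have := hx k
    by_cases hk : k = j
    · subst hk
      simp only [Pi.add_apply, latticeUnit_same]; omega
    · simpa [latticeUnit_ne hk] using this
  ext k
  have := hx k
  by_cases hk : k = j
  · subst hk
    simp only [clampBox, Pi.add_apply, latticeUnit_same]; omega
  · simp only [clampBox, Pi.add_apply, latticeUnit_ne hk]; omega

theorem clampBox_sub_unit {d : ℕ} {M x : Zd d} {j : Fin d} (hx : x ∈ dbox (fun _ => 1) M)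
    (h : x - latticeUnit j ∉ dbox (fun _ => 1) M) : clampBox M (x - latticeUnit j) = x := by
  rw [mem_dbox] at hx
  have hj : x j - 1 < 1 := by
    by_contra! hcon
    refine h (mem_dbox.2 fun k => ?_)
    have := hx k
    by_cases hk : k = j
    · subst hk
      simp only [Pi.sub_apply, latticeUnit_same]; omega
    · simpa [latticeUnit_ne hk] using this
  ext k
  have := hx k
  by_cases hk : k = j
  · subst hk
    simp only [clampBox, Pi.sub_apply, latticeUnit_same]; omega
  · simp only [clampBox, Pi.sub_apply, latticeUnit_ne hk]; omega

theorem neumannMat_mulVec {d : ℕ} {M : Zd d} {V w : Zd d → ℝ} (hw : IsReflecting M w)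
    (x : dbox (fun _ => 1) M) :
    (neumannMat (dbox (fun _ => 1) M) V).mulVec (fun y => w y) x = latticeOp V w x := by
  have hout : ∑ y ∈ (nbhd (x : Zd d)).filter (fun y => y ∉ dbox (fun _ => 1) M), w y
      = nOut (dbox (fun _ => 1) M) x * w x := by
    rw [nOut, ← nsmul_eq_mul, ← Finset.sum_const]
    refine Finset.sum_congr rfl fun y hy => ?_
    obtain ⟨hy1, hy2⟩ := Finset.mem_filter.1 hy
    obtain ⟨j, rfl | rfl⟩ := dist1_eq_one_iff.1 (mem_nbhd.1 hy1)
    · rw [← hw, clampBox_add_unit x.2 hy2]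
    · rw [← hw, clampBox_sub_unit x.2 hy2]
  have hin : ∑ y : dbox (fun _ => 1) M, (if dist1 (x : Zd d) y = 1 then (-1 : ℝ) else 0) * w y
      = -∑ y ∈ (nbhd (x : Zd d)).filter (fun y => y ∈ dbox (fun _ => 1) M), w y := by
    rw [Finset.sum_coe_sort (dbox (fun _ => 1) M)
      (fun y => (if dist1 (x : Zd d) y = 1 then (-1 : ℝ) else 0) * w y), ← Finset.sum_neg_distrib]
    simp only [ite_mul, zero_mul, ← Finset.sum_filter, neg_one_mul]
    refine Finset.sum_congr ?_ fun _ _ => rfl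
    ext y
    simp [mem_nbhd, and_comm]
  have hsplit := Finset.sum_filter_add_sum_filter_not (nbhd (x : Zd d))
    (fun y => y ∈ dbox (fun _ => 1) M) w
  rw [latticeOp, ← sum_nbhd, ← hsplit, hout]
  simp only [Matrix.mulVec, dotProduct, neumannMat, add_mul, Finset.sum_add_distrib, hin]
  simp only [ite_mul, zero_mul, Finset.sum_ite_eq, Finset.mem_univ, if_true]
  ring

theorem neumannMat_isHermitian {d : ℕ} (S : Finset (Zd d)) (V : Zd d → ℝ) :
    (neumannMat S V).IsHermitian := by
  ext x y
  have hd : dist1 (y : Zd d) x = dist1 (x : Zd d) y := by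
    simp only [dist1, abs_sub_comm]
  simp only [Matrix.conjTranspose_apply, neumannMat, star_trivial, hd]
  by_cases h : x = y
  · subst h; rfl
  · simp [h, Ne.symm h]

/-- The bottom of the spectrum of the Neumann operator bounds Rayleigh quotients. -/
theorem sInf_spectrum_neumannMat_mul_le {d : ℕ} {M : Zd d} {V w : Zd d → ℝ}
    (hw : IsReflecting M w) :
    sInf (spectrum ℝ (neumannMat (dbox (fun _ => 1) M) V)) * ∑ x ∈ dbox (fun _ => 1) M, w x * w x
      ≤ ∑ x ∈ dbox (fun _ => 1) M, w x * latticeOp V w x := by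
  have h := (neumannMat_isHermitian (dbox (fun _ => 1) M) V).sInf_spectrum_mul_le
    (fun y => w y)
  simp only [dotProduct, neumannMat_mulVec hw] at h
  rwa [Finset.sum_coe_sort (dbox (fun _ => 1) M) (fun y => w y * w y),
    Finset.sum_coe_sort (dbox (fun _ => 1) M) (fun y => w y * latticeOp V w y)] at h

/-- The zeros of a nonnegative eigenfunction propagate through the whole lattice. -/
theorem IsReflecting.eq_zero_of_nonneg {d : ℕ} {M : Zd d} (hM : ∀ j, 1 ≤ M j) {V w : Zd d → ℝ}
    (hw : IsReflecting M w) {E : ℝ} (heq : ∀ x ∈ dbox (fun _ => 1) M, latticeOp V w x = E * w x)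
    (hnn : ∀ x, 0 ≤ w x) {x₀ : Zd d} (hx₀ : w x₀ = 0) : w = 0 := by
  have hbox : ∀ x ∈ dbox (fun _ => 1) M, w x = 0 →
      ∀ j, w (x + latticeUnit j) = 0 ∧ w (x - latticeUnit j) = 0 := by
    intro x hx hx0 j
    have h := heq x hx
    rw [latticeOp, hx0, mul_zero, mul_zero, zero_sub, neg_eq_zero,
      Finset.sum_eq_zero_iff_of_nonneg fun k _ => add_nonneg (hnn _) (hnn _)] at h
    exact (add_eq_zero_iff_of_nonneg (hnn _) (hnn _)).1 (h j (Finset.mem_univ j))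
  have hadd : ∀ x j, w x = 0 → w (x + latticeUnit j) = 0 := by
    intro x j hx
    have h := (hbox _ (clampBox_mem hM x) ((hw x).trans hx) j).1
    by_cases hj : x j ≤ 0
    · have : clampBox M (x + latticeUnit j) = clampBox M x := by
        ext k
        have := hM k
        by_cases hk : k = j
        · subst hk
          simp only [clampBox, Pi.add_apply, latticeUnit_same]; omega
        · simp [clampBox, latticeUnit_ne hk]
      rw [← hw, this, hw, hx]
    · have : clampBox M (x + latticeUnit j) = clampBox M (clampBox M x + latticeUnit j) := by
        ext k
        have := hM k
        by_cases hk : k = j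
        · subst hk
          simp only [clampBox, Pi.add_apply, latticeUnit_same]; omega
        · simp only [clampBox, Pi.add_apply, latticeUnit_ne hk]; omega
      rw [← hw, this, hw, h]
  have hsub : ∀ x j, w x = 0 → w (x - latticeUnit j) = 0 := by
    intro x j hx
    have h := (hbox _ (clampBox_mem hM x) ((hw x).trans hx) j).2
    by_cases hj : M j < x j
    · have : clampBox M (x - latticeUnit j) = clampBox M x := by
        ext k
        have := hM k
        by_cases hk : k = j
        · subst hk
          simp only [clampBox, Pi.sub_apply, latticeUnit_same]; omega
        · simp [clampBox, latticeUnit_ne hk]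
      rw [← hw, this, hw, hx]
    · have : clampBox M (x - latticeUnit j) = clampBox M (clampBox M x - latticeUnit j) := by
        ext k
        have := hM k
        by_cases hk : k = j
        · subst hk
          simp only [clampBox, Pi.sub_apply, latticeUnit_same]; omega
        · simp only [clampBox, Pi.sub_apply, latticeUnit_ne hk]; omega
      rw [← hw, this, hw, h]
  let G : AddSubgroup (Zd d) :=
    { carrier := {v | ∀ x, w x = 0 ↔ w (x + v) = 0}
      zero_mem' := fun x => by simp
      add_mem' := fun {u v} hu hv x => by rw [← add_assoc]; exact (hu x).trans (hv _)
      neg_mem' := fun {v} hv x => by simpa using (hv (x + -v)).symm }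
  have hunit : ∀ j, latticeUnit j ∈ G := fun j x =>
    ⟨hadd x j, fun h => by simpa using hsub _ j h⟩
  have htop : ∀ v : Zd d, v ∈ G := by
    intro v
    rw [← Finset.univ_sum_single v]
    refine sum_mem fun j _ => ?_
    have : Pi.single j (v j) = v j • (latticeUnit j : Zd d) := by
      simp [latticeUnit, ← Pi.single_smul]
    rw [this]
    exact zsmul_mem (hunit j) _
  ext y
  simpa using (htop (y - x₀) x₀).1 hx₀

/-- Existence of a positive ground state. -/
theorem exists_pos_ground_state {d : ℕ} {M : Zd d} (hM : ∀ j, 1 ≤ M j) (V : Zd d → ℝ) :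
    ∃ w : Zd d → ℝ, IsReflecting M w ∧ (∀ x, 0 < w x) ∧ ∀ x ∈ dbox (fun _ => 1) M,
      latticeOp V w x = sInf (spectrum ℝ (neumannMat (dbox (fun _ => 1) M) V)) * w x := by
  have : Nonempty (dbox (fun _ => 1) M) := ⟨⟨_, clampBox_mem hM 0⟩⟩
  obtain ⟨u, hu0, hune, hu⟩ :=
    (neumannMat_isHermitian (dbox (fun _ => 1) M) V).exists_nonneg_ground_state (by
      intro x y hxy
      simp only [neumannMat, hxy, if_false, add_zero]
      split_ifs <;> norm_num)
  let w : Zd d → ℝ := fun x => u ⟨clampBox M x, clampBox_mem hM x⟩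
  have hwu : ∀ x : dbox (fun _ => 1) M, w x = u x := fun x => by
    simp only [w, clampBox_of_mem x.2]
  have hw : IsReflecting M w := fun x => by
    simp only [w, clampBox_of_mem (clampBox_mem hM x)]
  have heq : ∀ x ∈ dbox (fun _ => 1) M,
      latticeOp V w x = sInf (spectrum ℝ (neumannMat (dbox (fun _ => 1) M) V)) * w x := by
    intro x hx
    have h := congrFun hu ⟨x, hx⟩
    rw [← funext hwu, neumannMat_mulVec hw ⟨x, hx⟩] at h
    simpa using h
  refine ⟨w, hw, fun x => lt_of_le_of_ne (hu0 _) fun h => hune ?_, heq⟩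
  have := hw.eq_zero_of_nonneg hM heq (fun _ => hu0 _) h.symm
  ext y
  rw [← hwu, this]
  rfl

/-- The translate of `w` by `e`, made reflecting by precomposition with the projection. -/
def shiftInBox {d : ℕ} (M e : Zd d) (w : Zd d → ℝ) : Zd d → ℝ := fun x => w (clampBox M x - e)

theorem shiftInBox_isReflecting {d : ℕ} {M : Zd d} (hM : ∀ j, 1 ≤ M j) (e : Zd d)
    (w : Zd d → ℝ) : IsReflecting M (shiftInBox M e w) := fun x => by
  simp only [shiftInBox, clampBox_of_mem (clampBox_mem hM x)]

theorem IsReflecting.add_unit {d : ℕ} {M : Zd d} {w : Zd d → ℝ} (hw : IsReflecting M w)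
    {x : Zd d} (hx : x ∈ dbox (fun _ => 1) M) {j : Fin d}
    (h : x + latticeUnit j ∉ dbox (fun _ => 1) M) : w (x + latticeUnit j) = w x := by
  rw [← hw, clampBox_add_unit hx h]

theorem IsReflecting.sub_unit {d : ℕ} {M : Zd d} {w : Zd d → ℝ} (hw : IsReflecting M w)
    {x : Zd d} (hx : x ∈ dbox (fun _ => 1) M) {j : Fin d}
    (h : x - latticeUnit j ∉ dbox (fun _ => 1) M) : w (x - latticeUnit j) = w x := by
  rw [← hw, clampBox_sub_unit hx h]

theorem add_unit_mem_or_sub_unit_mem {d : ℕ} {M x : Zd d} {i : Fin d} (hMi : 2 ≤ M i)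
    (hx : x ∈ dbox (fun _ => 1) M) :
    x + latticeUnit i ∈ dbox (fun _ => 1) M ∨ x - latticeUnit i ∈ dbox (fun _ => 1) M := by
  simp only [mem_dbox] at hx ⊢
  rcases lt_or_ge (x i) (M i) with h | h
  · left
    intro k
    have := hx k
    by_cases hk : k = i
    · subst hk
      simp only [Pi.add_apply, latticeUnit_same]; omega
    · simpa [latticeUnit_ne hk] using this
  · right
    intro k
    have := hx k
    by_cases hk : k = i
    · subst hk
      simp only [Pi.sub_apply, latticeUnit_same]; omega
    · simpa [latticeUnit_ne hk] using this

theorem IsReflecting.clampBox_sub {d : ℕ} {M : Zd d} {w : Zd d → ℝ} (hw : IsReflecting M w)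
    {i : Fin d} {e z : Zd d} (he : ∀ k, k ≠ i → e k = 0) (hz : 1 ≤ z i ∧ z i ≤ M i) :
    w (clampBox M z - e) = w (z - e) := by
  rw [← hw, ← hw (z - e)]
  congr 1
  ext k
  by_cases hk : k = i
  · subst hk
    simp only [clampBox, Pi.sub_apply]; omega
  · simp only [clampBox, Pi.sub_apply, he k hk]; omega

theorem latticeOp_eq_sub_sub {d : ℕ} (V w : Zd d → ℝ) (x : Zd d) (i : Fin d) {e : Zd d}
    (he : e = latticeUnit i ∨ e = -latticeUnit i) :
    latticeOp V w x = V x * w x - (w (x + e) + w (x - e)) -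
      ∑ j ∈ Finset.univ.erase i, (w (x + latticeUnit j) + w (x - latticeUnit j)) := by
  rw [latticeOp, ← Finset.add_sum_erase _ _ (Finset.mem_univ i)]
  rcases he with rfl | rfl
  · ring
  · rw [sub_neg_eq_add, ← sub_eq_add_neg]
    ring

/-- The defect of a translated eigenfunction is concentrated on the two faces of the box
orthogonal to the translation. -/
theorem latticeOp_shiftInBox {d : ℕ} {M : Zd d} {V V' w : Zd d → ℝ} {E : ℝ}
    (hw : IsReflecting M w) (heq : ∀ x ∈ dbox (fun _ => 1) M, latticeOp V w x = E * w x)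
    {i : Fin d} (hMi : 2 ≤ M i) {e : Zd d} (he : e = latticeUnit i ∨ e = -latticeUnit i)
    (hV : ∀ x ∈ dbox (fun _ => 1) M, x - e ∈ dbox (fun _ => 1) M → V' x = V (x - e))
    (hV0 : ∀ x ∈ dbox (fun _ => 1) M, x - e ∉ dbox (fun _ => 1) M → V' x = V x)
    {x : Zd d} (hx : x ∈ dbox (fun _ => 1) M) :
    latticeOp V' (shiftInBox M e w) x - E * shiftInBox M e w x =
      (if x - e ∈ dbox (fun _ => 1) M then 0 else w (x + e) - w x) +
      (if x + e ∈ dbox (fun _ => 1) M then 0 else w x - w (x - e)) := by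
  have he0 : ∀ k, k ≠ i → e k = 0 := by
    rcases he with rfl | rfl <;> intro k hk <;> simp [latticeUnit_ne hk]
  have hor : x + e ∈ dbox (fun _ => 1) M ∨ x - e ∈ dbox (fun _ => 1) M := by
    rcases he with rfl | rfl
    · exact add_unit_mem_or_sub_unit_mem hMi hx
    · rw [sub_neg_eq_add, ← sub_eq_add_neg]
      exact (add_unit_mem_or_sub_unit_mem hMi hx).symm
  have hsub : x - e ∉ dbox (fun _ => 1) M → clampBox M (x - e) = x := by
    rcases he with rfl | rfl
    · exact clampBox_sub_unit hx
    · rw [sub_neg_eq_add]; exact clampBox_add_unit hx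
  have hadd : x + e ∉ dbox (fun _ => 1) M → clampBox M (x + e) = x := by
    rcases he with rfl | rfl
    · exact clampBox_add_unit hx
    · rw [← sub_eq_add_neg]; exact clampBox_sub_unit hx
  have hvx : shiftInBox M e w x = w (x - e) := by rw [shiftInBox, clampBox_of_mem hx]
  have hxi := mem_dbox.1 hx i
  have htrans : ∑ j ∈ Finset.univ.erase i, (shiftInBox M e w (x + latticeUnit j) +
      shiftInBox M e w (x - latticeUnit j)) = ∑ j ∈ Finset.univ.erase i,
        (w (x - e + latticeUnit j) + w (x - e - latticeUnit j)) := by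
    refine Finset.sum_congr rfl fun j hj => ?_
    have hji : i ≠ j := (Finset.ne_of_mem_erase hj).symm
    rw [shiftInBox, shiftInBox, hw.clampBox_sub he0, hw.clampBox_sub he0, sub_add_eq_add_sub,
      sub_right_comm]
    · simpa [latticeUnit_ne hji] using hxi
    · simpa [latticeUnit_ne hji] using hxi
  rw [latticeOp_eq_sub_sub V' _ x i he, htrans, hvx]
  by_cases hm : x - e ∈ dbox (fun _ => 1) M
  · have h := heq _ hm
    rw [latticeOp_eq_sub_sub V _ _ i he, sub_add_cancel] at h
    have h1 : shiftInBox M e w (x - e) = w (x - e - e) := by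
      rw [shiftInBox, clampBox_of_mem hm]
    rw [h1, hV x hx hm, if_pos hm]
    by_cases hp : x + e ∈ dbox (fun _ => 1) M
    · have h2 : shiftInBox M e w (x + e) = w x := by
        rw [shiftInBox, clampBox_of_mem hp, add_sub_cancel_right]
      rw [h2, if_pos hp]
      linarith
    · have h2 : shiftInBox M e w (x + e) = w (x - e) := by
        rw [shiftInBox, hadd hp]
      rw [h2, if_neg hp]
      linarith
  · have hp := hor.resolve_right hm
    have h := heq _ hx
    have hwx : w (x - e) = w x := by rw [← hw, hsub hm]
    rw [latticeOp_eq_sub_sub V _ _ i he, hwx] at h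
    have h1 : shiftInBox M e w (x - e) = w x := by
      rw [shiftInBox, hsub hm, hwx]
    have h2 : shiftInBox M e w (x + e) = w x := by
      rw [shiftInBox, clampBox_of_mem hp, add_sub_cancel_right]
    have hface : clampBox M (x - e) i = clampBox M x i := by rw [hsub hm, clampBox_of_mem hx]
    have h3 : ∀ y : Zd d, y i = x i → w (y - e) = w y := by
      intro y hy
      rw [← hw, ← hw y]
      congr 1
      ext k
      by_cases hk : k = i
      · subst hk
        simpa [clampBox, hy] using hface
      · simp [clampBox, he0 k hk]
    have h4 : ∑ j ∈ Finset.univ.erase i, (w (x - e + latticeUnit j) + w (x - e - latticeUnit j))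
        = ∑ j ∈ Finset.univ.erase i, (w (x + latticeUnit j) + w (x - latticeUnit j)) := by
      refine Finset.sum_congr rfl fun j hj => ?_
      have hji : i ≠ j := (Finset.ne_of_mem_erase hj).symm
      rw [sub_add_eq_add_sub, sub_right_comm, h3, h3] <;> simp [latticeUnit_ne hji]
    rw [h1, h2, h4, hV0 x hx hm, if_neg hm, if_pos hp, hwx]
    linarith

/-- Testing with the translated ground state. -/
theorem sub_mul_sum_shiftInBox_le {d : ℕ} {M : Zd d} (hM : ∀ j, 1 ≤ M j) {V V' w : Zd d → ℝ}
    {E : ℝ} (hw : IsReflecting M w)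
    (heq : ∀ x ∈ dbox (fun _ => 1) M, latticeOp V w x = E * w x)
    {i : Fin d} (hMi : 2 ≤ M i) {e : Zd d} (he : e = latticeUnit i ∨ e = -latticeUnit i)
    (hV : ∀ x ∈ dbox (fun _ => 1) M, x - e ∈ dbox (fun _ => 1) M → V' x = V (x - e))
    (hV0 : ∀ x ∈ dbox (fun _ => 1) M, x - e ∉ dbox (fun _ => 1) M → V' x = V x) :
    (sInf (spectrum ℝ (neumannMat (dbox (fun _ => 1) M) V')) - E) *
        ∑ x ∈ dbox (fun _ => 1) M, shiftInBox M e w x * shiftInBox M e w x ≤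
      ∑ x ∈ dbox (fun _ => 1) M,
        ((if x - e ∈ dbox (fun _ => 1) M then 0 else w x * (w (x + e) - w x)) +
        (if x + e ∈ dbox (fun _ => 1) M then 0 else w (x - e) * (w x - w (x - e)))) := by
  have h := sInf_spectrum_neumannMat_mul_le (V := V') (shiftInBox_isReflecting hM e w)
  have hsum : ∑ x ∈ dbox (fun _ => 1) M, shiftInBox M e w x * latticeOp V' (shiftInBox M e w) x =
      E * (∑ x ∈ dbox (fun _ => 1) M, shiftInBox M e w x * shiftInBox M e w x) +
      ∑ x ∈ dbox (fun _ => 1) M,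
        ((if x - e ∈ dbox (fun _ => 1) M then 0 else w x * (w (x + e) - w x)) +
        (if x + e ∈ dbox (fun _ => 1) M then 0 else w (x - e) * (w x - w (x - e)))) := by
    rw [Finset.mul_sum, ← Finset.sum_add_distrib]
    refine Finset.sum_congr rfl fun x hx => ?_
    have hres := latticeOp_shiftInBox hw heq hMi he hV hV0 hx
    rw [sub_eq_iff_eq_add'] at hres
    rw [hres, shiftInBox, clampBox_of_mem hx]
    have hwx : x - e ∉ dbox (fun _ => 1) M → w (x - e) = w x := by
      rcases he with rfl | rfl
      · exact hw.sub_unit hx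
      · rw [sub_neg_eq_add]; exact hw.add_unit hx
    split_ifs with h1 h2 h2
    · ring
    · ring
    · rw [hwx h1]; ring
    · rw [hwx h1]; ring
  rw [hsum] at h
  linarith

theorem sum_add_sub_eq_two_mul {G : Type*} [AddCommGroup G] [DecidableEq G] {S : Finset G}
    {f : G → ℝ} {e : G}
    (hadd : ∀ x ∈ S, x + e ∉ S → f (x + e) = f x) (hsub : ∀ x ∈ S, x - e ∉ S → f (x - e) = f x) :
    ∑ x ∈ S, (f (x + e) + f (x - e)) = 2 * ∑ x ∈ S, f x := by
  have h1 : ∑ x ∈ S, (f (x + e) - f x) = ∑ x ∈ S with x + e ∈ S, (f (x + e) - f x) := by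
    rw [Finset.sum_filter]
    refine Finset.sum_congr rfl fun x hx => ?_
    split_ifs with h
    · rfl
    · rw [hadd x hx h, sub_self]
  have h2 : ∑ x ∈ S, (f x - f (x - e)) = ∑ x ∈ S with x - e ∈ S, (f x - f (x - e)) := by
    rw [Finset.sum_filter]
    refine Finset.sum_congr rfl fun x hx => ?_
    split_ifs with h
    · rfl
    · rw [hsub x hx h, sub_self]
  have h3 : ∑ x ∈ S with x + e ∈ S, (f (x + e) - f x) =
      ∑ x ∈ S with x - e ∈ S, (f x - f (x - e)) :=
    Finset.sum_nbij' (· + e) (· - e) (by simp +contextual) (by simp +contextual) (by simp)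
      (by simp) (by simp)
  rw [← h1, ← h2, Finset.sum_sub_distrib, Finset.sum_sub_distrib] at h3
  rw [Finset.sum_add_distrib]
  linarith

/-- The kinetic part has zero total mass on a set with the reflecting boundary condition. -/
theorem sum_latticeOp {d : ℕ} {S : Finset (Zd d)} (V : Zd d → ℝ) {w : Zd d → ℝ}
    (hadd : ∀ j, ∀ x ∈ S, x + latticeUnit j ∉ S → w (x + latticeUnit j) = w x)
    (hsub : ∀ j, ∀ x ∈ S, x - latticeUnit j ∉ S → w (x - latticeUnit j) = w x) :
    ∑ x ∈ S, latticeOp V w x = ∑ x ∈ S, V x * w x - 2 * d * ∑ x ∈ S, w x := by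
  simp only [latticeOp, Finset.sum_sub_distrib]
  rw [Finset.sum_comm, Finset.sum_congr rfl fun j _ => sum_add_sub_eq_two_mul (hadd j) (hsub j)]
  simp
  ring

theorem IsReflecting.sum_latticeOp {d : ℕ} {M : Zd d} (V : Zd d → ℝ) {w : Zd d → ℝ}
    (hw : IsReflecting M w) :
    ∑ x ∈ dbox (fun _ => 1) M, latticeOp V w x =
      ∑ x ∈ dbox (fun _ => 1) M, V x * w x - 2 * d * ∑ x ∈ dbox (fun _ => 1) M, w x :=
  _root_.sum_latticeOp V (fun _ _ hx h => hw.add_unit hx h) (fun _ _ hx h => hw.sub_unit hx h)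

/-- If the normal difference of a positive eigenfunction vanishes on a face where the potential
vanishes, then the eigenvalue is that of the constant function. -/
theorem eigenvalue_eq_of_face {d : ℕ} {M : Zd d} (hM : ∀ j, 1 ≤ M j) {V w : Zd d → ℝ}
    {E : ℝ} (hw : IsReflecting M w) (hpos : ∀ x, 0 < w x)
    (heq : ∀ x ∈ dbox (fun _ => 1) M, latticeOp V w x = E * w x) {i : Fin d}
    (hV : ∀ x ∈ dbox (fun _ => 1) M, x - latticeUnit i ∉ dbox (fun _ => 1) M → V x = 0)
    (hface : ∀ x ∈ dbox (fun _ => 1) M, x - latticeUnit i ∉ dbox (fun _ => 1) M →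
      w (x + latticeUnit i) = w x) : E = -(2 * d) := by
  set F := (dbox (fun _ => 1) M).filter fun x => x - latticeUnit i ∉ dbox (fun _ => 1) M with hF
  have hmem : ∀ x, x ∈ F ↔ x ∈ dbox (fun _ => 1) M ∧ x i = 1 := by
    intro x
    rw [hF, Finset.mem_filter]
    refine and_congr_right fun hx => ⟨fun h => ?_, fun h h' => ?_⟩
    · have := congrFun (clampBox_sub_unit hx h) i
      have := mem_dbox.1 hx i
      simp only [clampBox, Pi.sub_apply, latticeUnit_same] at *
      by_contra hne
      refine h (mem_dbox.2 fun k => ?_)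
      have := mem_dbox.1 hx k
      by_cases hk : k = i
      · subst hk
        simp only [Pi.sub_apply, latticeUnit_same]; omega
      · simpa [latticeUnit_ne hk] using this
    · have := (mem_dbox.1 h' i).1
      simp only [Pi.sub_apply, latticeUnit_same] at this
      omega
  have hsum := _root_.sum_latticeOp (S := F) V (w := w) (fun j x hx h => by
      obtain ⟨hxΛ, hxF⟩ := Finset.mem_filter.1 hx
      by_cases hj : j = i
      · subst hj
        exact hface x hxΛ hxF
      · refine hw.add_unit hxΛ fun h' => h ((hmem _).2 ⟨h', ?_⟩)
        simpa [latticeUnit_ne (Ne.symm hj)] using ((hmem x).1 hx).2) (fun j x hx h => by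
      obtain ⟨hxΛ, hxF⟩ := Finset.mem_filter.1 hx
      by_cases hj : j = i
      · subst hj
        exact hw.sub_unit hxΛ hxF
      · refine hw.sub_unit hxΛ fun h' => h ((hmem _).2 ⟨h', ?_⟩)
        simpa [latticeUnit_ne (Ne.symm hj)] using ((hmem x).1 hx).2)
  have h1 : ∑ x ∈ F, latticeOp V w x = E * ∑ x ∈ F, w x := by
    rw [Finset.mul_sum]
    exact Finset.sum_congr rfl fun x hx => heq x (Finset.mem_filter.1 hx).1
  have h2 : ∑ x ∈ F, V x * w x = 0 := Finset.sum_eq_zero fun x hx => by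
    obtain ⟨hxΛ, hxF⟩ := Finset.mem_filter.1 hx
    rw [hV x hxΛ hxF, zero_mul]
  have h3 : 0 < ∑ x ∈ F, w x := Finset.sum_pos (fun x _ => hpos x)
    ⟨fun _ => 1, (hmem _).2 ⟨mem_dbox.2 fun j => ⟨le_rfl, hM j⟩, rfl⟩⟩
  rw [h1, h2] at hsum
  refine mul_right_cancel₀ h3.ne' ?_
  linarith

/-- Strict concavity of the ground state energy under translations of the potential, weighted by
the norms of the translated ground state. -/
theorem exists_weighted_second_difference_neg {d : ℕ} {M : Zd d} (hM : ∀ j, 1 ≤ M j)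
    {V V₁ V₂ : Zd d → ℝ} {i : Fin d} (hMi : 2 ≤ M i)
    (hV₁ : ∀ x, V₁ x = V (x - latticeUnit i)) (hV₂ : ∀ x, V₂ x = V (x + latticeUnit i))
    (h₁ : ∀ x ∈ dbox (fun _ => 1) M, x - latticeUnit i ∉ dbox (fun _ => 1) M →
      V₁ x = 0 ∧ V x = 0)
    (h₂ : ∀ x ∈ dbox (fun _ => 1) M, x + latticeUnit i ∉ dbox (fun _ => 1) M →
      V₂ x = 0 ∧ V x = 0)
    (hsign : (∀ x, 0 ≤ V x) ∨ (∀ x, V x ≤ 0)) (hne : ∃ x ∈ dbox (fun _ => 1) M, V x ≠ 0) :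
    ∃ N₁ > 0, ∃ N₂ > 0,
      (sInf (spectrum ℝ (neumannMat (dbox (fun _ => 1) M) V₁)) -
        sInf (spectrum ℝ (neumannMat (dbox (fun _ => 1) M) V))) * N₁ +
      (sInf (spectrum ℝ (neumannMat (dbox (fun _ => 1) M) V₂)) -
        sInf (spectrum ℝ (neumannMat (dbox (fun _ => 1) M) V))) * N₂ < 0 := by
  obtain ⟨w, hw, hpos, heq⟩ := exists_pos_ground_state hM V
  have hboxne : (dbox (fun _ => 1) M).Nonempty := ⟨_, clampBox_mem hM 0⟩
  set E := sInf (spectrum ℝ (neumannMat (dbox (fun _ => 1) M) V))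
  refine ⟨∑ x ∈ dbox (fun _ => 1) M,
      shiftInBox M (latticeUnit i) w x * shiftInBox M (latticeUnit i) w x,
    Finset.sum_pos (fun x _ => mul_pos (hpos _) (hpos _)) hboxne, ∑ x ∈ dbox (fun _ => 1) M,
      shiftInBox M (-latticeUnit i) w x * shiftInBox M (-latticeUnit i) w x,
    Finset.sum_pos (fun x _ => mul_pos (hpos _) (hpos _)) hboxne, ?_⟩
  have hle₁ := sub_mul_sum_shiftInBox_le hM (V' := V₁) hw heq hMi (Or.inl rfl)
    (fun x _ _ => hV₁ x) (fun x hx h => (h₁ x hx h).1.trans (h₁ x hx h).2.symm)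
  have hle₂ := sub_mul_sum_shiftInBox_le hM (V' := V₂) hw heq hMi (Or.inr rfl)
    (fun x _ _ => by rw [sub_neg_eq_add]; exact hV₂ x)
    (fun x hx h => by
      rw [sub_neg_eq_add] at h
      exact (h₂ x hx h).1.trans (h₂ x hx h).2.symm)
  refine (add_le_add hle₁ hle₂).trans_lt ?_
  rw [← Finset.sum_add_distrib]
  simp only [sub_neg_eq_add, ← sub_eq_add_neg]
  have hEne : ¬∀ x ∈ dbox (fun _ => 1) M, x - latticeUnit i ∉ dbox (fun _ => 1) M →
      w (x + latticeUnit i) = w x := by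
    intro hface
    have hE := eigenvalue_eq_of_face hM hw hpos heq (fun x hx h => (h₁ x hx h).2) hface
    have hsum := hw.sum_latticeOp V
    rw [Finset.sum_congr rfl heq, ← Finset.mul_sum, hE] at hsum
    have hVw : ∑ x ∈ dbox (fun _ => 1) M, V x * w x = 0 := by linarith
    obtain ⟨x, hx, hVx⟩ := hne
    refine hVx ?_
    rcases hsign with hs | hs
    · rw [Finset.sum_eq_zero_iff_of_nonneg fun y _ => mul_nonneg (hs y) (hpos y).le] at hVw
      exact (mul_eq_zero.1 (hVw x hx)).resolve_right (hpos x).ne'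
    · rw [Finset.sum_eq_zero_iff_of_nonpos
        fun y _ => mul_nonpos_of_nonpos_of_nonneg (hs y) (hpos y).le] at hVw
      exact (mul_eq_zero.1 (hVw x hx)).resolve_right (hpos x).ne'
  push Not at hEne
  obtain ⟨x₀, hx₀, hm₀, hx₀ne⟩ := hEne
  refine Finset.sum_neg' (fun x hx => ?_) ⟨x₀, hx₀, ?_⟩
  · split_ifs <;> nlinarith [sq_nonneg (w (x + latticeUnit i) - w x),
      sq_nonneg (w x - w (x - latticeUnit i))]
  · have hp₀ := (add_unit_mem_or_sub_unit_mem hMi hx₀).resolve_right hm₀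
    rw [if_neg hm₀, if_pos hp₀, if_neg hm₀, if_pos hp₀]
    nlinarith [sq_pos_of_ne_zero (sub_ne_zero.2 hx₀ne)]

/-- The reflection of the box `∏ [1, M j]` in direction `i`. -/
def reflectBox {d : ℕ} (M : Zd d) (i : Fin d) (x : Zd d) : Zd d :=
  Function.update x i (M i + 1 - x i)

theorem reflectBox_mem {d : ℕ} {M x : Zd d} (i : Fin d) (hx : x ∈ dbox (fun _ => 1) M) :
    reflectBox M i x ∈ dbox (fun _ => 1) M := by
  rw [mem_dbox] at hx ⊢
  intro k
  have := hx k
  by_cases hk : k = i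
  · subst hk
    simp only [reflectBox, Function.update_self]; omega
  · simpa [reflectBox, hk] using this

theorem reflectBox_add_unit {d : ℕ} (M x : Zd d) {i j : Fin d} :
    reflectBox M i (x + latticeUnit j) =
      if j = i then reflectBox M i x - latticeUnit j else reflectBox M i x + latticeUnit j := by
  split_ifs with h <;> ext k <;> by_cases hk : k = i <;>
    simp [reflectBox, latticeUnit, Pi.single_apply, Function.update_apply, hk, h, eq_comm]; ring

theorem reflectBox_sub_unit {d : ℕ} (M x : Zd d) {i j : Fin d} :
    reflectBox M i (x - latticeUnit j) =
      if j = i then reflectBox M i x + latticeUnit j else reflectBox M i x - latticeUnit j := by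
  split_ifs with h <;> ext k <;> by_cases hk : k = i <;>
    simp [reflectBox, latticeUnit, Pi.single_apply, Function.update_apply, hk, h, eq_comm]; ring

theorem sInf_spectrum_neumannMat_le_of_reflect {d : ℕ} {M : Zd d} (hM : ∀ j, 1 ≤ M j)
    {V V' : Zd d → ℝ} {i : Fin d} (hV : ∀ x, V' x = V (reflectBox M i x)) :
    sInf (spectrum ℝ (neumannMat (dbox (fun _ => 1) M) V')) ≤
      sInf (spectrum ℝ (neumannMat (dbox (fun _ => 1) M) V)) := by
  obtain ⟨w, hw, hpos, heq⟩ := exists_pos_ground_state hM V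
  have hw' : IsReflecting M (fun x => w (reflectBox M i x)) := by
    intro x
    change w _ = w _
    rw [← hw, ← hw (reflectBox M i x)]
    congr 1
    ext k
    have := hM k
    by_cases hk : k = i
    · subst hk
      simp only [clampBox, reflectBox, Function.update_self]; omega
    · simp only [clampBox, reflectBox, Function.update_of_ne hk]; omega
  have hop : ∀ x, latticeOp V' (fun x => w (reflectBox M i x)) x =
      latticeOp V w (reflectBox M i x) := by
    intro x
    simp only [latticeOp, hV]
    congr 1
    refine Finset.sum_congr rfl fun j _ => ?_
    rw [reflectBox_add_unit, reflectBox_sub_unit]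
    split_ifs
    · exact add_comm _ _
    · rfl
  have h := sInf_spectrum_neumannMat_mul_le (V := V') hw'
  have hsum : ∑ x ∈ dbox (fun _ => 1) M, w (reflectBox M i x) *
      latticeOp V' (fun x => w (reflectBox M i x)) x =
      sInf (spectrum ℝ (neumannMat (dbox (fun _ => 1) M) V)) *
        ∑ x ∈ dbox (fun _ => 1) M, w (reflectBox M i x) * w (reflectBox M i x) := by
    rw [Finset.mul_sum]
    refine Finset.sum_congr rfl fun x hx => ?_
    rw [hop, heq _ (reflectBox_mem i hx)]
    ring
  rw [hsum] at h
  exact le_of_mul_le_mul_right h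
    (Finset.sum_pos (fun x _ => mul_pos (hpos _) (hpos _)) ⟨_, clampBox_mem hM 0⟩)

theorem E0_update_reflect {d : ℕ} {M b : Zd d} (hM : ∀ j, 1 ≤ M j) {q : Zd d → ℝ}
    (hH1 : ∀ (x : Zd d) (i : Fin d), q x = q (Function.update x i (b i - x i + 1)))
    (i : Fin d) (a : Zd d) (t : ℤ) :
    E0 M q (Function.update a i (M i - b i - t)) = E0 M q (Function.update a i t) := by
  have key : ∀ s, E0 M q (Function.update a i (M i - b i - s)) ≤
      E0 M q (Function.update a i s) := by
    intro s
    refine sInf_spectrum_neumannMat_le_of_reflect (i := i) hM fun x => ?_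
    rw [hH1 _ i]
    congr 1
    ext k
    by_cases hk : k = i
    · subst hk
      simp only [reflectBox, Function.update_self, Pi.sub_apply]; ring
    · simp [reflectBox, hk]
  refine le_antisymm (key t) ?_
  simpa using key (M i - b i - t)

/-- A symmetric sequence with negative weighted second differences decreases away from the
centre. -/
theorem strictAntiOn_of_weighted_second_difference_neg {f : ℤ → ℝ} {L : ℤ}
    (hsymm : ∀ t, f (L - t) = f t)
    (hstep : ∀ t, 1 ≤ t → t + 1 ≤ L → ∃ N₁ > 0, ∃ N₂ > 0,
      (f (t + 1) - f t) * N₁ + (f (t - 1) - f t) * N₂ < 0) :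
    StrictAntiOn f (Set.Icc ((L + 1) / 2) L) := by
  have hnext : ∀ t, 1 ≤ t → t + 1 ≤ L → f t ≤ f (t - 1) → f (t + 1) < f t := by
    intro t h1 h2 hle
    obtain ⟨N₁, hN₁, N₂, hN₂, h⟩ := hstep t h1 h2
    by_contra! hcon
    have := mul_nonneg (sub_nonneg.2 hcon) hN₁.le
    have := mul_nonneg (sub_nonneg.2 hle) hN₂.le
    linarith
  have hdec : ∀ t, (L + 1) / 2 ≤ t → 0 ≤ L → t + 1 ≤ L → f (t + 1) < f t := by
    intro t ht hL
    induction t, ht using Int.leInduction with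
    | base =>
      intro h
      rcases Int.even_or_odd' L with ⟨m, rfl | rfl⟩
      · have hm : (2 * m + 1) / 2 = m := by omega
        rw [hm] at h ⊢
        have hs := hsymm (m - 1)
        rw [show 2 * m - (m - 1) = m + 1 by ring] at hs
        obtain ⟨N₁, hN₁, N₂, hN₂, hneg⟩ := hstep m (by omega) h
        rw [← hs] at hneg
        by_contra! hcon
        have := mul_nonneg (sub_nonneg.2 hcon) hN₁.le
        have := mul_nonneg (sub_nonneg.2 hcon) hN₂.le
        linarith
      · have hm : (2 * m + 1 + 1) / 2 = m + 1 := by omega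
        refine hnext _ (by omega) h ?_
        rw [hm, add_sub_cancel_right]
        have hs := hsymm m
        rw [show 2 * m + 1 - m = m + 1 by ring] at hs
        exact hs.le
    | succ n hn ih =>
      intro h
      refine hnext _ (by omega) h ?_
      rw [add_sub_cancel_right]
      exact (ih (by omega)).le
  refine strictAntiOn_of_add_one_lt Set.ordConnected_Icc fun t _ ht ht' => ?_
  exact hdec t ht.1 (by have := ht.1; have := ht.2; omega) ht'.2

/-- **Bubbles tend to the corners** (sign-definite case).  If `q ≠ 0` is sign-definite,
supported in `B = ∏ [1, b i]` and reflection symmetric in each variable (H1), then for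
any fixed `i` and fixed `a_j ∈ [r_j, M_j - b_j]` for `j ≠ i`, the map
`a_i ↦ E_0(a_1, …, a_d)` is strictly decreasing on `[r_i, M_i - b_i]`,
where `r_j = ⌈(M_j - b_j)/2⌉ = (M_j - b_j + 1)/2`. -/
theorem bubbles_tend_to_corners
    (d : ℕ) (hd : 1 ≤ d) (M b : Zd d)
    (hb : ∀ i, 1 ≤ b i) (hbM : ∀ i, b i ≤ M i)
    (q : Zd d → ℝ)
    (hsupp : ∀ n, n ∉ dbox (fun _ => 1) b → q n = 0)
    (hH1 : ∀ (x : Zd d) (i : Fin d), q x = q (Function.update x i (b i - x i + 1)))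
    (hq0 : q ≠ 0)
    (hsign : (∀ n, 0 ≤ q n) ∨ (∀ n, q n ≤ 0))
    (i : Fin d) (a : Zd d)
    (ha : ∀ j, j ≠ i → (M j - b j + 1) / 2 ≤ a j ∧ a j ≤ M j - b j) :
    StrictAntiOn (fun t : ℤ => E0 M q (Function.update a i t))
      (Set.Icc ((M i - b i + 1) / 2) (M i - b i)) := by
  have hM : ∀ j, 1 ≤ M j := fun j => (hb j).trans (hbM j)
  refine strictAntiOn_of_weighted_second_difference_neg (E0_update_reflect hM hH1 i a)
    fun t ht1 ht2 => ?_
  have hbi := hb i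
  have hout : ∀ (s : ℤ) (x : Zd d), x i - s < 1 ∨ b i < x i - s →
      q (x - Function.update a i s) = 0 := by
    intro s x hx
    refine hsupp _ fun h => ?_
    have := mem_dbox.1 h i
    simp only [Pi.sub_apply, Function.update_self] at this
    omega
  refine exists_weighted_second_difference_neg hM (i := i)
    (V := fun n => q (n - Function.update a i t))
    (V₁ := fun n => q (n - Function.update a i (t + 1)))
    (V₂ := fun n => q (n - Function.update a i (t - 1))) (by omega) (fun x => ?_) (fun x => ?_)
    (fun x hx h => ?_) (fun x hx h => ?_) (hsign.imp (fun h x => h _) fun h x => h _) ?_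
  · congr 1
    ext k
    by_cases hk : k = i
    · subst hk
      simp only [Pi.sub_apply, Function.update_self, latticeUnit_same]; ring
    · simp [hk, latticeUnit_ne hk]
  · congr 1
    ext k
    by_cases hk : k = i
    · subst hk
      simp only [Pi.sub_apply, Pi.add_apply, Function.update_self, latticeUnit_same]; ring
    · simp [hk, latticeUnit_ne hk]
  · have hc := congrFun (clampBox_sub_unit hx h) i
    simp only [clampBox, Pi.sub_apply, latticeUnit_same] at hc
    have := mem_dbox.1 hx i
    exact ⟨hout _ _ (by omega), hout _ _ (by omega)⟩
  · have hc := congrFun (clampBox_add_unit hx h) i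
    simp only [clampBox, Pi.add_apply, latticeUnit_same] at hc
    have := mem_dbox.1 hx i
    exact ⟨hout _ _ (by omega), hout _ _ (by omega)⟩
  · obtain ⟨n, hn⟩ := Function.ne_iff.1 hq0
    have hnb : n ∈ dbox (fun _ => 1) b := by
      by_contra h
      exact hn (hsupp n h)
    refine ⟨n + Function.update a i t, mem_dbox.2 fun k => ?_, by simpa using hn⟩
    have h1 := mem_dbox.1 hnb k
    by_cases hk : k = i
    · subst hk
      simp only [Pi.add_apply, Function.update_self]; omega
    · have h2 := ha k hk
      have h3 := hbM k
      simp only [Pi.add_apply, Function.update_of_ne hk]; omega
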